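/- Let L be a nondegenerate even ℤ-lattice, M ⊆ L a primitive nondegenerate sublattice, M⊥ its orthogonal complement, S(L) = L/(M ⊕ M⊥), and let S₁ ⊆ l(M) and S₂ ⊆ l(M⊥) be the images of S(L) under the injective maps induced by the orthogonal projections, with γ : S₁ → S₂ the resulting isomorphism (so S(L) is the graph of γ). Let φ : M → M and ψ : M⊥ → M⊥ be isometries, and let φ̄ : l(M) → l(M) and ψ̄ : l(M⊥) → l(M⊥) be the maps induced by their ℚ-linear extensions to the dual lattices. Then φ ⊕ ψ extends to an isometry of L (equivalently, the ℚ-linear map φ ⊗ ℚ ⊕ ψ ⊗ ℚ on L ⊗ ℚ maps L into L) if and only if φ̄(S₁) = S₁, ψ̄(S₂) = S₂, and γ ∘ φ̄ = ψ̄ ∘ γ on S₁. -/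

import Mathlib

open scoped TensorProduct

noncomputable section

namespace Stmt13

variable {L : Type} [AddCommGroup L] [Module ℤ L]

/-- The canonical inclusion `L → ℚ ⊗[ℤ] L`. -/
def incl : L →ₗ[ℤ] ℚ ⊗[ℤ] L := TensorProduct.mk ℤ ℚ L 1

/-- The ℚ-bilinear extension of an integral bilinear form to `ℚ ⊗[ℤ] L`. -/
def BQ (B : L →ₗ[ℤ] L →ₗ[ℤ] ℤ) :
    (ℚ ⊗[ℤ] L) →ₗ[ℚ] (ℚ ⊗[ℤ] L) →ₗ[ℚ] ℚ :=
  LinearMap.BilinForm.baseChange ℚ B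

/-- The orthogonal complement of a submodule `M` in the lattice `(L, B)`. -/
def orth (B : L →ₗ[ℤ] L →ₗ[ℤ] ℤ) (M : Submodule ℤ L) : Submodule ℤ L where
  carrier := {v | ∀ m ∈ M, B v m = 0}
  add_mem' := by
    intro a b ha hb m hm
    simp [map_add, ha m hm, hb m hm]
  zero_mem' := by
    intro m hm
    simp
  smul_mem' := by
    intro c v hv m hm
    simp [map_smul, hv m hm]

/-- The dual lattice `N* = {v ∈ N ⊗ ℚ : B(v, w) ∈ ℤ for all w ∈ N}` of a sublattice `N`
of `L`, realized inside the ℚ-span of `N` in `ℚ ⊗[ℤ] L`. -/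
def relDual (B : L →ₗ[ℤ] L →ₗ[ℤ] ℤ) (N : Submodule ℤ L) : Submodule ℤ (ℚ ⊗[ℤ] L) where
  carrier := {v | v ∈ Submodule.span ℚ (incl '' (N : Set L)) ∧
                  ∀ w ∈ N, ∃ n : ℤ, BQ B v (incl w) = n}
  add_mem' := by
    intro a b ha hb
    refine ⟨Submodule.add_mem _ ha.1 hb.1, fun w hw => ?_⟩
    obtain ⟨m, hm⟩ := ha.2 w hw
    obtain ⟨n, hn⟩ := hb.2 w hw
    exact ⟨m + n, by simp [map_add, hm, hn]⟩
  zero_mem' := ⟨Submodule.zero_mem _, fun w hw => ⟨0, by simp⟩⟩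
  smul_mem' := by
    intro c v hv
    refine ⟨by
      rw [← Int.cast_smul_eq_zsmul ℚ]
      exact Submodule.smul_mem _ _ hv.1, fun w hw => ?_⟩
    obtain ⟨n, hn⟩ := hv.2 w hw
    refine ⟨c * n, ?_⟩
    rw [LinearMap.map_smul_of_tower, LinearMap.smul_apply, hn, zsmul_eq_mul]
    push_cast
    ring

/-- The copy of `N` inside the dual lattice `N*`. -/
def latticeInDual (B : L →ₗ[ℤ] L →ₗ[ℤ] ℤ) (N : Submodule ℤ L) :
    Submodule ℤ ↥(relDual B N) :=
  Submodule.comap (relDual B N).subtype (N.map incl)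

/-- The discriminant group `l(N) = N*/N` of a sublattice `N` of `L`. -/
abbrev discGroup (B : L →ₗ[ℤ] L →ₗ[ℤ] ℤ) (N : Submodule ℤ L) :=
  ↥(relDual B N) ⧸ latticeInDual B N

/-- The submodule of `N*` consisting of the orthogonal projections to `N ⊗ ℚ` of the
vectors of `L`; here `P` is the complementary sublattice, so that the projection of `v`
to `N ⊗ ℚ` is the unique `x ∈ N ⊗ ℚ` with `v - x ∈ P ⊗ ℚ`. -/
def projLattice (B : L →ₗ[ℤ] L →ₗ[ℤ] ℤ) (N P : Submodule ℤ L) :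
    Submodule ℤ ↥(relDual B N) where
  carrier := {x | ∃ v : L, incl v - (x : ℚ ⊗[ℤ] L) ∈
    Submodule.span ℚ (incl '' (P : Set L))}
  add_mem' := by
    rintro a b ⟨v, hv⟩ ⟨w, hw⟩
    refine ⟨v + w, ?_⟩
    have : incl (v + w) - ((a : ℚ ⊗[ℤ] L) + (b : ℚ ⊗[ℤ] L)) =
        (incl v - (a : ℚ ⊗[ℤ] L)) + (incl w - (b : ℚ ⊗[ℤ] L)) := by
      rw [map_add]; abel
    rw [Submodule.coe_add, this]
    exact Submodule.add_mem _ hv hw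
  zero_mem' := ⟨0, by simp⟩
  smul_mem' := by
    rintro c x ⟨v, hv⟩
    refine ⟨c • v, ?_⟩
    have : incl (c • v) - ((c • x : ↥(relDual B N)) : ℚ ⊗[ℤ] L) =
        c • (incl v - (x : ℚ ⊗[ℤ] L)) := by
      rw [Submodule.coe_smul, smul_sub]
      congr 1
      exact map_zsmul incl.toAddMonoidHom c v
    rw [this, ← Int.cast_smul_eq_zsmul ℚ]
    exact Submodule.smul_mem _ _ hv

/-- The image `S₁` (resp. `S₂`) of the glue group `S(L)` in the discriminant group of `N`,
for `N` a primitive sublattice with complementary sublattice `P`. -/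
def glueImage (B : L →ₗ[ℤ] L →ₗ[ℤ] ℤ) (N P : Submodule ℤ L) :
    Submodule ℤ (discGroup B N) :=
  (projLattice B N P).map (Submodule.mkQ (latticeInDual B N))

variable {A : Type} [AddCommGroup A]

theorem incl_smul (n : ℤ) (v : A) : incl (n • v) = (n : ℚ) • incl v := by
  rw [map_zsmul, Int.cast_smul_eq_zsmul]

theorem BQ_incl (B : A →ₗ[ℤ] A →ₗ[ℤ] ℤ) (a b : A) : BQ B (incl a) (incl b) = B a b := by
  refine (LinearMap.BilinForm.baseChange_tmul B 1 a 1 b).trans ?_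
  simp

theorem incl_injective [Module.Free ℤ A] :
    Function.Injective (incl : A → ℚ ⊗[ℤ] A) := by
  have h := (Module.Flat.rTensor_preserves_injective_linearMap (M := A) (Algebra.linearMap ℤ ℚ)
    Int.cast_injective).comp (TensorProduct.lid ℤ A).symm.injective
  intro a b hab
  refine h ?_
  change (1 : ℚ) ⊗ₜ[ℤ] a = (1 : ℚ) ⊗ₜ[ℤ] b at hab
  simpa using hab

theorem eq_of_zsmul_eq_zsmul [Module.Free ℤ A] {n : ℤ} (hn : n ≠ 0) {a b : A}
    (h : n • a = n • b) : a = b := by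
  apply incl_injective
  have h' := congrArg incl h
  rw [incl_smul, incl_smul] at h'
  exact smul_right_injective _ (Int.cast_ne_zero.mpr hn) h'

theorem exists_smul_eq_incl {N : Submodule ℤ A} {x : ℚ ⊗[ℤ] A}
    (hx : x ∈ Submodule.span ℚ (incl '' (N : Set A))) :
    ∃ n : ℤ, n ≠ 0 ∧ ∃ m ∈ N, (n : ℚ) • x = incl m := by
  induction hx using Submodule.span_induction with
  | mem x hx =>
    obtain ⟨m, hm, rfl⟩ := hx
    exact ⟨1, one_ne_zero, m, hm, by simp⟩
  | zero => exact ⟨1, one_ne_zero, 0, N.zero_mem, by simp⟩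
  | add x y _ _ hx hy =>
    obtain ⟨n, hn, m, hm, h⟩ := hx
    obtain ⟨n', hn', m', hm', h'⟩ := hy
    refine ⟨n * n', mul_ne_zero hn hn', n' • m + n • m',
      N.add_mem (N.smul_mem _ hm) (N.smul_mem _ hm'), ?_⟩
    rw [map_add, incl_smul, incl_smul, ← h, ← h']
    push_cast
    module
  | smul q x _ hx =>
    obtain ⟨n, hn, m, hm, h⟩ := hx
    refine ⟨q.den * n, mul_ne_zero (by exact_mod_cast q.den_ne_zero) hn, q.num • m,
      N.smul_mem _ hm, ?_⟩
    rw [incl_smul, ← h, smul_smul, smul_smul]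
    congr 1
    push_cast
    rw [← Rat.den_mul_eq_num q]
    ring

theorem mem_span_incl_top (x : ℚ ⊗[ℤ] A) :
    x ∈ Submodule.span ℚ (incl '' ((⊤ : Submodule ℤ A) : Set A)) := by
  induction x using TensorProduct.induction_on with
  | zero => exact Submodule.zero_mem _
  | tmul q v =>
    have : q ⊗ₜ[ℤ] v = q • incl v := by
      change _ = q • ((1 : ℚ) ⊗ₜ[ℤ] v)
      rw [TensorProduct.smul_tmul', smul_eq_mul, mul_one]
    rw [this]
    exact Submodule.smul_mem _ _ (Submodule.subset_span ⟨v, trivial, rfl⟩)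
  | add x y hx hy => exact Submodule.add_mem _ hx hy

theorem BQ_symm (B : A →ₗ[ℤ] A →ₗ[ℤ] ℤ) (hsymm : ∀ x y : A, B x y = B y x)
    (x y : ℚ ⊗[ℤ] A) : BQ B x y = BQ B y x := by
  obtain ⟨n, hn, a, -, ha⟩ := exists_smul_eq_incl (mem_span_incl_top x)
  obtain ⟨k, hk, b, -, hb⟩ := exists_smul_eq_incl (mem_span_incl_top y)
  have h : BQ B ((n : ℚ) • x) ((k : ℚ) • y) = BQ B ((k : ℚ) • y) ((n : ℚ) • x) := by
    rw [ha, hb, BQ_incl, BQ_incl, hsymm]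
  simp only [map_smul, LinearMap.smul_apply, smul_eq_mul] at h
  have hn' : (n : ℚ) ≠ 0 := Int.cast_ne_zero.mpr hn
  have hk' : (k : ℚ) ≠ 0 := Int.cast_ne_zero.mpr hk
  rw [mul_left_comm] at h
  exact mul_left_cancel₀ hn' (mul_left_cancel₀ hk' (by linarith))

theorem BQ_eq_zero_of_mem_span (B : A →ₗ[ℤ] A →ₗ[ℤ] ℤ) {N P : Submodule ℤ A}
    (h : ∀ a ∈ N, ∀ b ∈ P, B a b = 0) {x y : ℚ ⊗[ℤ] A}
    (hx : x ∈ Submodule.span ℚ (incl '' (N : Set A)))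
    (hy : y ∈ Submodule.span ℚ (incl '' (P : Set A))) : BQ B x y = 0 := by
  obtain ⟨n, hn, a, ha, hxa⟩ := exists_smul_eq_incl hx
  obtain ⟨k, hk, b, hb, hyb⟩ := exists_smul_eq_incl hy
  have h' : BQ B ((n : ℚ) • x) ((k : ℚ) • y) = 0 := by
    rw [hxa, hyb, BQ_incl, h a ha b hb, Int.cast_zero]
  simpa [hn, hk] using h'

theorem isCompl_span_incl [Module.Finite ℤ A] (B : A →ₗ[ℤ] A →ₗ[ℤ] ℤ)
    (hsymm : ∀ x y : A, B x y = B y x) (M : Submodule ℤ A)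
    (hM : ∀ v ∈ M, (∀ w ∈ M, B v w = 0) → v = 0) :
    IsCompl (Submodule.span ℚ (incl '' (M : Set A)))
      (Submodule.span ℚ (incl '' (orth B M : Set A))) := by
  set W := Submodule.span ℚ (incl '' (M : Set A))
  have horth : LinearMap.BilinForm.orthogonal (BQ B) W =
      Submodule.span ℚ (incl '' (orth B M : Set A)) := by
    apply le_antisymm
    · intro x hx
      obtain ⟨n, hn, a, -, ha⟩ := exists_smul_eq_incl (mem_span_incl_top x)
      have hn' : (n : ℚ) ≠ 0 := Int.cast_ne_zero.mpr hn
      rw [← Submodule.smul_mem_iff _ hn', ha]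
      refine Submodule.subset_span ⟨a, fun m hm => ?_, rfl⟩
      have h0 : BQ B (incl m) x = 0 := hx _ (Submodule.subset_span ⟨m, hm, rfl⟩)
      have h1 : BQ B (incl m) (incl a) = 0 := by rw [← ha, map_smul, h0, smul_zero]
      rw [BQ_incl, Int.cast_eq_zero] at h1
      rw [hsymm, h1]
    · intro x hx y hy
      exact BQ_eq_zero_of_mem_span B
        (fun a ha b (hb : b ∈ orth B M) => (hsymm a b).trans (hb a ha)) hy hx
  rw [← horth, LinearMap.BilinForm.isCompl_orthogonal_iff_disjoint
    (fun x y h => by rw [BQ_symm B hsymm, h]), Submodule.disjoint_def]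
  intro x hx hx'
  obtain ⟨n, hn, m, hm, h⟩ := exists_smul_eq_incl hx
  have hn' : (n : ℚ) ≠ 0 := Int.cast_ne_zero.mpr hn
  have hm0 : m = 0 := by
    refine hM m hm fun w hw => ?_
    have h0 : BQ B (incl w) x = 0 := hx' _ (Submodule.subset_span ⟨w, hw, rfl⟩)
    have h1 : BQ B (incl w) (incl m) = 0 := by rw [← h, map_smul, h0, smul_zero]
    rw [BQ_incl, Int.cast_eq_zero] at h1
    rw [hsymm, h1]
  rw [hm0, map_zero] at h
  exact (smul_eq_zero.mp h).resolve_left hn'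

theorem mem_relDual_of_add_eq_incl (B : A →ₗ[ℤ] A →ₗ[ℤ] ℤ) {N P : Submodule ℤ A}
    (hPN : ∀ a ∈ P, ∀ b ∈ N, B a b = 0) {x y : ℚ ⊗[ℤ] A}
    (hx : x ∈ Submodule.span ℚ (incl '' (N : Set A)))
    (hy : y ∈ Submodule.span ℚ (incl '' (P : Set A)))
    {v : A} (hv : x + y = incl v) : x ∈ relDual B N := by
  refine ⟨hx, fun w hw => ⟨B v w, ?_⟩⟩
  have h0 := BQ_eq_zero_of_mem_span B hPN hy (Submodule.subset_span ⟨w, hw, rfl⟩)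
  rw [← BQ_incl, ← hv, map_add, LinearMap.add_apply, h0, add_zero]

/-- The rational extension of an isometry of a sublattice, on a vector of the dual lattice. -/
theorem exists_dual_image [Module.Free ℤ A] (B : A →ₗ[ℤ] A →ₗ[ℤ] ℤ) (N : Submodule ℤ A)
    (χ : N ≃ₗ[ℤ] N) (hχ : ∀ a b : N, B (χ a : A) (χ b : A) = B (a : A) (b : A))
    (x : relDual B N) :
    ∃ x' : relDual B N,
      (∀ w : N, BQ B (x' : ℚ ⊗[ℤ] A) (incl (χ w : A)) = BQ B (x : ℚ ⊗[ℤ] A) (incl (w : A))) ∧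
      ∀ (n : ℤ) (m : N), (n : ℚ) • (x : ℚ ⊗[ℤ] A) = incl (m : A) →
        (n : ℚ) • (x' : ℚ ⊗[ℤ] A) = incl (χ m : A) := by
  obtain ⟨k, hk, m₀, hm₀, h₀⟩ := exists_smul_eq_incl x.2.1
  lift m₀ to N using hm₀
  have hk' : (k : ℚ) ≠ 0 := Int.cast_ne_zero.mpr hk
  have hx : (x : ℚ ⊗[ℤ] A) = (k : ℚ)⁻¹ • incl (m₀ : A) := by
    rw [← h₀, inv_smul_smul₀ hk']
  have hB : ∀ w : N, BQ B ((k : ℚ)⁻¹ • incl (χ m₀ : A)) (incl (χ w : A)) =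
      BQ B (x : ℚ ⊗[ℤ] A) (incl (w : A)) := by
    intro w
    rw [hx, map_smul, map_smul, LinearMap.smul_apply, LinearMap.smul_apply, BQ_incl, BQ_incl, hχ]
  refine ⟨⟨(k : ℚ)⁻¹ • incl (χ m₀ : A), ?_, fun w hw => ?_⟩, hB, fun n m hnm => ?_⟩
  · exact Submodule.smul_mem _ _ (Submodule.subset_span ⟨_, (χ m₀).2, rfl⟩)
  · obtain ⟨u, hu⟩ := χ.surjective ⟨w, hw⟩
    obtain ⟨j, hj⟩ := x.2.2 u u.2
    have := hB u
    rw [hu, hj] at this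
    exact ⟨j, this⟩
  · have h1 : n • m₀ = k • m := by
      apply Subtype.ext
      apply incl_injective
      rw [AddSubgroupClass.coe_zsmul, AddSubgroupClass.coe_zsmul, incl_smul, incl_smul,
        ← hnm, ← h₀]
      module
    have h2 := congrArg (fun z : N => incl (z : A)) (congrArg χ h1)
    simp only [map_zsmul, AddSubgroupClass.coe_zsmul] at h2
    rw [← Int.cast_smul_eq_zsmul ℚ n, ← Int.cast_smul_eq_zsmul ℚ k] at h2
    change (n : ℚ) • ((k : ℚ)⁻¹ • incl (χ m₀ : A)) = _
    rw [smul_comm, h2, inv_smul_smul₀ hk']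

/-- An isometric endomorphism of a nondegenerate lattice is bijective. -/
theorem exists_equiv_of_isometry [Module.Free ℤ A] [Module.Finite ℤ A]
    (B : A →ₗ[ℤ] A →ₗ[ℤ] ℤ) (hsymm : ∀ x y : A, B x y = B y x)
    (hnondeg : ∀ v : A, (∀ w : A, B v w = 0) → v = 0)
    (f : A →ₗ[ℤ] A) (hf : ∀ a b, B (f a) (f b) = B a b) :
    ∃ Φ : A ≃ₗ[ℤ] A, ∀ v, Φ v = f v := by
  classical
  let b := Module.Free.chooseBasis ℤ A
  have hB : LinearMap.BilinForm.Nondegenerate B :=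
    ⟨hnondeg, fun v h => hnondeg v fun w => (hsymm v w).trans (h w)⟩
  have hdet := (LinearMap.BilinForm.nondegenerate_iff_det_ne_zero b).mp hB
  have hcomp : LinearMap.BilinForm.comp B f f = B := by
    ext x y
    exact hf x y
  have h := congrArg Matrix.det (LinearMap.BilinForm.toMatrix_comp b b B f f)
  rw [hcomp, Matrix.det_mul, Matrix.det_mul, Matrix.det_transpose] at h
  have hu : IsUnit (LinearMap.toMatrix b b f).det := by
    refine .of_mul_eq_one (LinearMap.toMatrix b b f).det (mul_right_cancel₀ hdet ?_)
    rw [one_mul]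
    nth_rewrite 2 [h]
    ring
  exact ⟨LinearEquiv.ofIsUnitDet hu, fun v => rfl⟩

theorem baseChange_incl (f : A →ₗ[ℤ] A) (v : A) : f.baseChange ℚ (incl v) = incl (f v) := rfl

theorem BQ_baseChange (B : A →ₗ[ℤ] A →ₗ[ℤ] ℤ) (f : A →ₗ[ℤ] A)
    (hf : ∀ a b, B (f a) (f b) = B a b) (x y : ℚ ⊗[ℤ] A) :
    BQ B (f.baseChange ℚ x) (f.baseChange ℚ y) = BQ B x y := by
  obtain ⟨n, hn, a, -, ha⟩ := exists_smul_eq_incl (mem_span_incl_top x)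
  obtain ⟨k, hk, b, -, hb⟩ := exists_smul_eq_incl (mem_span_incl_top y)
  have h : BQ B (f.baseChange ℚ ((n : ℚ) • x)) (f.baseChange ℚ ((k : ℚ) • y)) =
      BQ B ((n : ℚ) • x) ((k : ℚ) • y) := by
    rw [ha, hb, baseChange_incl, baseChange_incl, BQ_incl, BQ_incl, hf]
  simpa [hn, hk] using h

theorem baseChange_mem_span {N : Submodule ℤ A} {f : A →ₗ[ℤ] A} (hf : ∀ a ∈ N, f a ∈ N)
    {x : ℚ ⊗[ℤ] A} (hx : x ∈ Submodule.span ℚ (incl '' (N : Set A))) :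
    f.baseChange ℚ x ∈ Submodule.span ℚ (incl '' (N : Set A)) := by
  obtain ⟨n, hn, m, hm, h⟩ := exists_smul_eq_incl hx
  have hn' : (n : ℚ) ≠ 0 := Int.cast_ne_zero.mpr hn
  rw [← Submodule.smul_mem_iff _ hn', ← map_smul, h, baseChange_incl]
  exact Submodule.subset_span ⟨_, hf m hm, rfl⟩

theorem baseChange_mem_relDual (B : A →ₗ[ℤ] A →ₗ[ℤ] ℤ) {N : Submodule ℤ A} (Φ : A ≃ₗ[ℤ] A)
    (hΦ : ∀ a b, B (Φ a) (Φ b) = B a b) (hN : ∀ a ∈ N, Φ a ∈ N) (hN' : ∀ a ∈ N, Φ.symm a ∈ N)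
    {x : ℚ ⊗[ℤ] A} (hx : x ∈ relDual B N) :
    (Φ : A →ₗ[ℤ] A).baseChange ℚ x ∈ relDual B N := by
  refine ⟨baseChange_mem_span hN hx.1, fun w hw => ?_⟩
  obtain ⟨n, hn⟩ := hx.2 _ (hN' w hw)
  refine ⟨n, ?_⟩
  rw [← hn, ← BQ_baseChange B (Φ : A →ₗ[ℤ] A) hΦ x, baseChange_incl]
  simp

theorem map_glueImage_eq (B : A →ₗ[ℤ] A →ₗ[ℤ] ℤ) {N P : Submodule ℤ A} (Φ : A ≃ₗ[ℤ] A)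
    (hΦ : ∀ a b, B (Φ a) (Φ b) = B a b) (hN : ∀ a ∈ N, Φ a ∈ N) (hN' : ∀ a ∈ N, Φ.symm a ∈ N)
    (hP : ∀ a ∈ P, Φ a ∈ P) (hP' : ∀ a ∈ P, Φ.symm a ∈ P)
    (χbar : discGroup B N →ₗ[ℤ] discGroup B N)
    (hχbar : ∀ x y : relDual B N,
      (y : ℚ ⊗[ℤ] A) = (Φ : A →ₗ[ℤ] A).baseChange ℚ (x : ℚ ⊗[ℤ] A) →
      χbar (Submodule.Quotient.mk x) = Submodule.Quotient.mk y) :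
    (glueImage B N P).map χbar = glueImage B N P := by
  have hproj : ∀ (Ψ : A ≃ₗ[ℤ] A), (∀ a ∈ P, Ψ a ∈ P) → ∀ x y : relDual B N,
      (y : ℚ ⊗[ℤ] A) = (Ψ : A →ₗ[ℤ] A).baseChange ℚ (x : ℚ ⊗[ℤ] A) →
      x ∈ projLattice B N P → y ∈ projLattice B N P := by
    rintro Ψ hΨ x y hxy ⟨v, hv⟩
    refine ⟨Ψ v, ?_⟩
    have := baseChange_mem_span (f := (Ψ : A →ₗ[ℤ] A)) hΨ hv
    rwa [map_sub, ← hxy, baseChange_incl] at this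
  have hΦ' : ∀ a b, B (Φ.symm a) (Φ.symm b) = B a b := fun a b => by
    rw [← hΦ, Φ.apply_symm_apply, Φ.apply_symm_apply]
  apply le_antisymm
  · rintro _ ⟨_, ⟨x, hx, rfl⟩, rfl⟩
    let y : relDual B N := ⟨_, baseChange_mem_relDual B Φ hΦ hN hN' x.2⟩
    exact ⟨y, hproj Φ hP x y rfl hx, (hχbar x y rfl).symm⟩
  · rintro _ ⟨y, hy, rfl⟩
    let x : relDual B N :=
      ⟨_, baseChange_mem_relDual B Φ.symm hΦ' hN' (by simpa using hN) y.2⟩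
    refine ⟨_, ⟨x, hproj Φ.symm hP' y x rfl hy, rfl⟩, hχbar x y ?_⟩
    change (y : ℚ ⊗[ℤ] A) = ((Φ : A →ₗ[ℤ] A).baseChange ℚ)
      (((Φ.symm : A →ₗ[ℤ] A).baseChange ℚ) (y : ℚ ⊗[ℤ] A))
    rw [← LinearMap.comp_apply, ← LinearMap.baseChange_comp]
    simp

theorem sub_mem_map_incl_of_mk_eq (B : A →ₗ[ℤ] A →ₗ[ℤ] ℤ) {N : Submodule ℤ A}
    {x y : relDual B N}
    (h : (Submodule.Quotient.mk x : discGroup B N) = Submodule.Quotient.mk y) :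
    (x : ℚ ⊗[ℤ] A) - y ∈ N.map incl :=
  (Submodule.Quotient.eq (latticeInDual B N)).mp h

/-- Isometries of a sublattice and of its orthogonal complement that preserve the glue vectors
extend to the whole lattice. -/
theorem exists_extension [Module.Free ℤ A] [Module.Finite ℤ A]
    (B : A →ₗ[ℤ] A →ₗ[ℤ] ℤ) (hsymm : ∀ x y : A, B x y = B y x)
    (hnondeg : ∀ v : A, (∀ w : A, B v w = 0) → v = 0)
    (M : Submodule ℤ A)
    (φ : M ≃ₗ[ℤ] M) (hφ : ∀ a b : M, B (φ a : A) (φ b : A) = B (a : A) (b : A))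
    (ψ : orth B M ≃ₗ[ℤ] orth B M)
    (hψ : ∀ a b : orth B M, B (ψ a : A) (ψ b : A) = B (a : A) (b : A))
    (hfin : ∀ v : A, ∃ n : ℤ, n ≠ 0 ∧ ∃ (m : M) (p : orth B M), n • v = (m : A) + (p : A))
    (hext : ∀ v : A, ∃ v' : A, ∀ (n : ℤ) (m : M) (p : orth B M),
      n • v = (m : A) + (p : A) → n • v' = (φ m : A) + (ψ p : A)) :
    ∃ Φ : A ≃ₗ[ℤ] A,
        (∀ a b : A, B (Φ a) (Φ b) = B a b) ∧
        (∀ a : M, Φ (a : A) = (φ a : A)) ∧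
        (∀ a : orth B M, Φ (a : A) = (ψ a : A)) := by
  choose F hF using hext
  have hadd : ∀ v w, F (v + w) = F v + F w := by
    intro v w
    obtain ⟨n, hn, m, p, h⟩ := hfin v
    obtain ⟨k, hk, m', p', h'⟩ := hfin w
    apply eq_of_zsmul_eq_zsmul (mul_ne_zero hn hk)
    have e : (n * k) • (v + w) = ((k • m + n • m' : M) : A) + ((k • p + n • p' : orth B M) : A) := by
      push_cast
      linear_combination (norm := module) k • h + n • h'
    rw [hF _ _ _ _ e]
    have e1 := hF _ _ _ _ h
    have e2 := hF _ _ _ _ h'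
    simp only [map_add, map_zsmul]
    push_cast
    linear_combination (norm := module) -k • e1 - n • e2
  let f : A →ₗ[ℤ] A :=
    { toFun := F
      map_add' := hadd
      map_smul' := fun c v => by
        obtain ⟨n, hn, m, p, h⟩ := hfin v
        apply eq_of_zsmul_eq_zsmul hn
        have e : n • (c • v) = ((c • m : M) : A) + ((c • p : orth B M) : A) := by
          push_cast
          linear_combination (norm := module) c • h
        have e1 := hF _ _ _ _ h
        refine (hF _ _ _ _ e).trans ?_
        simp only [map_zsmul, RingHom.id_apply]
        push_cast
        linear_combination (norm := module) -c • e1 }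
  have hf : ∀ a b, B (f a) (f b) = B a b := by
    intro v w
    obtain ⟨n, hn, m, p, h⟩ := hfin v
    obtain ⟨k, hk, m', p', h'⟩ := hfin w
    have e1 : n • f v = _ := hF _ _ _ _ h
    have e2 : k • f w = _ := hF _ _ _ _ h'
    have o : ∀ (a : M) (b : orth B M), B (a : A) (b : A) = 0 := fun a b => by
      rw [hsymm, b.2 a a.2]
    have o' : ∀ (a : M) (b : orth B M), B (b : A) (a : A) = 0 := fun a b => b.2 a a.2
    have key : B (n • f v) (k • f w) = B (n • v) (k • w) := by
      rw [e1, e2, h, h']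
      simp only [map_add, LinearMap.add_apply, o, o', hφ, hψ]
    simp only [map_zsmul, LinearMap.smul_apply, smul_eq_mul] at key
    exact mul_left_cancel₀ hn (mul_left_cancel₀ hk (by linarith))
  obtain ⟨Φ, hΦ⟩ := exists_equiv_of_isometry B hsymm hnondeg f hf
  refine ⟨Φ, fun a b => by rw [hΦ, hΦ, hf], fun a => ?_, fun a => ?_⟩
  · rw [hΦ]
    change F a = _
    simpa using hF a 1 a 0 (by simp)
  · rw [hΦ]
    change F a = _
    simpa using hF a 1 0 a (by simp)

/-- Nikulin's gluing criterion: let `L` be a nondegenerate even lattice,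
`M` a primitive nondegenerate sublattice with orthogonal complement `M⊥`, `S₁ ⊆ l(M)` and
`S₂ ⊆ l(M⊥)` the (isomorphic) images of `S(L) = L/(M ⊕ M⊥)` under the projections.  Let
`φ, ψ` be isometries of `M, M⊥` and `φ̄, ψ̄` the induced maps on the discriminant groups
(given here as data, characterized by: if `y ∈ M*` satisfies `B(y, φ(w)) = B(x, w)` for
all `w ∈ M` — i.e. `y = φ_ℚ(x)` — then `φ̄[x] = [y]`, and similarly for `ψ̄`).  Then
`φ ⊕ ψ` extends to an isometry of `L` if and only if `φ̄(S₁) = S₁`, `ψ̄(S₂) = S₂`, and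
`γ ∘ φ̄ = ψ̄ ∘ γ` on `S₁`, where `γ : S₁ → S₂` is the gluing isomorphism (on classes of
glue pairs `x + y ∈ L`, it sends `[x]` to `[y]`). -/
theorem isometry_extends_iff_glue_conditions
    [Module.Free ℤ L] [Module.Finite ℤ L]
    (B : L →ₗ[ℤ] L →ₗ[ℤ] ℤ)
    (hsymm : ∀ x y : L, B x y = B y x)
    (heven : ∀ v : L, ∃ k : ℤ, B v v = 2 * k)
    (hnondeg : ∀ v : L, (∀ w : L, B v w = 0) → v = 0)
    (M : Submodule ℤ L)
    (hprim : ∀ (n : ℤ) (x : L ⧸ M), n • x = 0 → n = 0 ∨ x = 0)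
    (hMnondeg : ∀ v ∈ M, (∀ w ∈ M, B v w = 0) → v = 0)
    (φ : ↥M ≃ₗ[ℤ] ↥M)
    (hφ : ∀ a b : ↥M, B (φ a : L) (φ b : L) = B (a : L) (b : L))
    (ψ : ↥(orth B M) ≃ₗ[ℤ] ↥(orth B M))
    (hψ : ∀ a b : ↥(orth B M), B (ψ a : L) (ψ b : L) = B (a : L) (b : L))
    (φbar : discGroup B M →ₗ[ℤ] discGroup B M)
    (hφbar : ∀ x y : ↥(relDual B M),
      (∀ w : ↥M, BQ B (y : ℚ ⊗[ℤ] L) (incl (φ w : L)) =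
                 BQ B (x : ℚ ⊗[ℤ] L) (incl (w : L))) →
      φbar (Submodule.Quotient.mk x) = Submodule.Quotient.mk y)
    (ψbar : discGroup B (orth B M) →ₗ[ℤ] discGroup B (orth B M))
    (hψbar : ∀ x y : ↥(relDual B (orth B M)),
      (∀ w : ↥(orth B M), BQ B (y : ℚ ⊗[ℤ] L) (incl (ψ w : L)) =
                          BQ B (x : ℚ ⊗[ℤ] L) (incl (w : L))) →
      ψbar (Submodule.Quotient.mk x) = Submodule.Quotient.mk y) :
    (∃ Φ : L ≃ₗ[ℤ] L,
        (∀ a b : L, B (Φ a) (Φ b) = B a b) ∧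
        (∀ a : ↥M, Φ (a : L) = (φ a : L)) ∧
        (∀ a : ↥(orth B M), Φ (a : L) = (ψ a : L))) ↔
    ((glueImage B M (orth B M)).map φbar = glueImage B M (orth B M) ∧
     (glueImage B (orth B M) M).map ψbar = glueImage B (orth B M) M ∧
     ∀ (x : ↥(relDual B M)) (y : ↥(relDual B (orth B M))),
       (∃ v : L, incl v = (x : ℚ ⊗[ℤ] L) + (y : ℚ ⊗[ℤ] L)) →
       ∀ (x' : ↥(relDual B M)) (y' : ↥(relDual B (orth B M))),
         φbar (Submodule.Quotient.mk x) = Submodule.Quotient.mk x' →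
         ψbar (Submodule.Quotient.mk y) = Submodule.Quotient.mk y' →
         ∃ v' : L, incl v' - ((x' : ℚ ⊗[ℤ] L) + (y' : ℚ ⊗[ℤ] L)) ∈
           (M.map incl) ⊔ ((orth B M).map incl)) := by
  obtain rfl : ‹Module ℤ L› = AddCommGroup.toIntModule L := Subsingleton.elim _ _
  have hcompl := isCompl_span_incl B hsymm M hMnondeg
  have horth : ∀ a ∈ orth B M, ∀ b ∈ M, B a b = 0 := fun a ha b hb => ha b hb
  have horth' : ∀ a ∈ M, ∀ b ∈ orth B M, B a b = 0 := fun a ha b hb =>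
    (hsymm a b).trans (hb a ha)
  constructor
  · rintro ⟨Φ, hΦ, hΦφ, hΦψ⟩
    have hM : ∀ a ∈ M, Φ a ∈ M := fun a ha => by
      rw [hΦφ ⟨a, ha⟩]
      exact (φ _).2
    have hP : ∀ a ∈ orth B M, Φ a ∈ orth B M := fun a ha => by
      rw [hΦψ ⟨a, ha⟩]
      exact (ψ _).2
    have hM' : ∀ a ∈ M, Φ.symm a ∈ M := fun a ha => by
      obtain ⟨u, hu⟩ := φ.surjective ⟨a, ha⟩
      have : a = Φ u := by rw [hΦφ, hu]
      rw [this, Φ.symm_apply_apply]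
      exact u.2
    have hP' : ∀ a ∈ orth B M, Φ.symm a ∈ orth B M := fun a ha => by
      obtain ⟨u, hu⟩ := ψ.surjective ⟨a, ha⟩
      have : a = Φ u := by rw [hΦψ, hu]
      rw [this, Φ.symm_apply_apply]
      exact u.2
    have hφ' : ∀ x y : relDual B M,
        (y : ℚ ⊗[ℤ] L) = (Φ : L →ₗ[ℤ] L).baseChange ℚ (x : ℚ ⊗[ℤ] L) →
        φbar (Submodule.Quotient.mk x) = Submodule.Quotient.mk y := fun x y hxy =>
      hφbar x y fun w => by
        rw [hxy, ← hΦφ, ← BQ_baseChange B (Φ : L →ₗ[ℤ] L) hΦ x]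
        rfl
    have hψ' : ∀ x y : relDual B (orth B M),
        (y : ℚ ⊗[ℤ] L) = (Φ : L →ₗ[ℤ] L).baseChange ℚ (x : ℚ ⊗[ℤ] L) →
        ψbar (Submodule.Quotient.mk x) = Submodule.Quotient.mk y := fun x y hxy =>
      hψbar x y fun w => by
        rw [hxy, ← hΦψ, ← BQ_baseChange B (Φ : L →ₗ[ℤ] L) hΦ x]
        rfl
    refine ⟨map_glueImage_eq B Φ hΦ hM hM' hP hP' φbar hφ',
      map_glueImage_eq B Φ hΦ hP hP' hM hM' ψbar hψ', ?_⟩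
    rintro x y ⟨v, hv⟩ x' y' hx' hy'
    rw [hφ' x ⟨_, baseChange_mem_relDual B Φ hΦ hM hM' x.2⟩ rfl] at hx'
    rw [hψ' y ⟨_, baseChange_mem_relDual B Φ hΦ hP hP' y.2⟩ rfl] at hy'
    refine ⟨Φ v, ?_⟩
    have e : incl (Φ v) = (Φ : L →ₗ[ℤ] L).baseChange ℚ (incl v) := rfl
    rw [e, hv, map_add, add_sub_add_comm]
    exact Submodule.add_mem_sup (sub_mem_map_incl_of_mk_eq B hx')
      (sub_mem_map_incl_of_mk_eq B hy')
  · rintro ⟨-, -, hglue⟩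
    have hdecomp : ∀ v : L, ∃ (x : relDual B M) (y : relDual B (orth B M)),
        incl v = (x : ℚ ⊗[ℤ] L) + (y : ℚ ⊗[ℤ] L) := by
      intro v
      have hv : incl v ∈ Submodule.span ℚ (incl '' (M : Set L)) ⊔
          Submodule.span ℚ (incl '' (orth B M : Set L)) := by
        rw [hcompl.sup_eq_top]
        trivial
      obtain ⟨x, hx, y, hy, hxy⟩ := Submodule.mem_sup.mp hv
      exact ⟨⟨x, mem_relDual_of_add_eq_incl B horth hx hy hxy⟩,
        ⟨y, mem_relDual_of_add_eq_incl B horth' hy hx ((add_comm y x).trans hxy)⟩, hxy.symm⟩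
    refine exists_extension B hsymm hnondeg M φ hφ ψ hψ (fun v => ?_) fun v => ?_
    · obtain ⟨x, y, hv⟩ := hdecomp v
      obtain ⟨n, hn, m, hm, h⟩ := exists_smul_eq_incl x.2.1
      obtain ⟨k, hk, p, hp, h'⟩ := exists_smul_eq_incl y.2.1
      refine ⟨n * k, mul_ne_zero hn hk, k • ⟨m, hm⟩, n • ⟨p, hp⟩, incl_injective ?_⟩
      rw [AddSubgroupClass.coe_zsmul, AddSubgroupClass.coe_zsmul, map_add, incl_smul, incl_smul,
        incl_smul, hv, ← h, ← h']
      push_cast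
      module
    · obtain ⟨x, y, hv⟩ := hdecomp v
      obtain ⟨x', hx', hx''⟩ := exists_dual_image B M φ hφ x
      obtain ⟨y', hy', hy''⟩ := exists_dual_image B (orth B M) ψ hψ y
      obtain ⟨v', hv'⟩ := hglue x y ⟨v, hv⟩ x' y' (hφbar x x' hx') (hψbar y y' hy')
      obtain ⟨_, ⟨a, -, rfl⟩, _, ⟨b, -, rfl⟩, hab⟩ := Submodule.mem_sup.mp hv'
      refine ⟨v' - (a + b), fun n m p hnmp => incl_injective ?_⟩
      have h := congrArg incl hnmp
      rw [incl_smul, hv, map_add, smul_add] at h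
      have hsub : (n : ℚ) • (x : ℚ ⊗[ℤ] L) - incl (m : L) =
          incl (p : L) - (n : ℚ) • (y : ℚ ⊗[ℤ] L) := by
        rw [sub_eq_sub_iff_add_eq_add, h, add_comm]
      have hzero : (n : ℚ) • (x : ℚ ⊗[ℤ] L) - incl (m : L) = 0 := by
        refine Submodule.disjoint_def.mp hcompl.disjoint _ ?_ ?_
        · exact Submodule.sub_mem _ (Submodule.smul_mem _ _ x.2.1)
            (Submodule.subset_span ⟨_, m.2, rfl⟩)
        · rw [hsub]
          exact Submodule.sub_mem _ (Submodule.subset_span ⟨_, p.2, rfl⟩)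
            (Submodule.smul_mem _ _ y.2.1)
      have hm := hx'' n m (sub_eq_zero.mp hzero)
      have hp := hy'' n p (sub_eq_zero.mp (hsub.symm.trans hzero)).symm
      have hsum : incl (v' - (a + b)) = (x' : ℚ ⊗[ℤ] L) + (y' : ℚ ⊗[ℤ] L) := by
        rw [map_sub, map_add, hab]
        abel
      rw [incl_smul, hsum, smul_add, hm, hp, map_add]

end Stmt13
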